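/- Let P=(A,C) and Q=(B,D) be measuring α-pairings (A, B unital) and (ξ,θ): (B,D) → (A,C) a morphism of measuring pairings. Regard D as a left C-comodule via (θ⊗id_D)∘Δ_D, and for a counital right C-comodule N with induced A-action a·n = Σ n_{<0>}⟨a,n_{<1>}⟩, regard Hom_A(B,N) (B an A-module via ξ) as a left B-module via (b'·f)(b)=f(bb'). Then the map γ_N: N□_C D → Hom_A(B,N), Σ nᵢ⊗dᵢ ↦ (b ↦ Σ nᵢ⟨b,dᵢ⟩_Q), is a well-defined injective B-linear map whose image equals the D-rational part Rat^D(Hom_A(B,N)), with inverse on that image given by f ↦ Σ f_{<0>}(1_B)⊗f_{<1>}; γ_N is natural in N. In particular the cotensor functor −□_C D and the coinduction functor Coind_P^Q = Rat^D(Hom_A(B,−)) are isomorphic functors from counital right C-comodules to counital right D-comodules. -/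

import Mathlib

open TensorProduct

universe u

/-- The canonical map `α^P_M : M ⊗ C → Hom(A, M)` associated to an `R`-pairing
`β : A → C → R`, sending `Σ mᵢ ⊗ cᵢ` to `a ↦ Σ ⟨a, cᵢ⟩ • mᵢ`. -/
noncomputable def alphaMap (R : Type u) [CommRing R]
    {A : Type u} [AddCommGroup A] [Module R A]
    {C : Type u} [AddCommGroup C] [Module R C]
    (β : A →ₗ[R] C →ₗ[R] R)
    (M : Type u) [AddCommGroup M] [Module R M] :
    (M ⊗[R] C) →ₗ[R] (A →ₗ[R] M) :=
  (dualTensorHom R A M) ∘ₗ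
    (TensorProduct.comm R M (Module.Dual R A)).toLinearMap ∘ₗ
    (TensorProduct.map LinearMap.id β.flip)

/-- `(A, C)` is a measuring pairing: `κ_P : A → C*` is multiplicative into the
convolution algebra `C*`. -/
def IsMeasuring (R : Type u) [CommRing R]
    {A : Type u} [NonUnitalRing A] [Module R A]
    {C : Type u} [AddCommGroup C] [Module R C] [Coalgebra R C]
    (β : A →ₗ[R] C →ₗ[R] R) : Prop :=
  ∀ a b : A,
    β (a * b) =
      (LinearMap.mul' R R) ∘ₗ (TensorProduct.map (β a) (β b)) ∘ₗ
        (Coalgebra.comul (R := R) (A := C))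

/-- The rational submodule `Rat^C(M)` of a module with `A`-action `σ`. -/
noncomputable def ratSubmodule (R : Type u) [CommRing R]
    {A : Type u} [AddCommGroup A] [Module R A]
    {C : Type u} [AddCommGroup C] [Module R C]
    (β : A →ₗ[R] C →ₗ[R] R)
    {M : Type u} [AddCommGroup M] [Module R M]
    (σ : A →ₗ[R] M →ₗ[R] M) : Submodule R M :=
  (LinearMap.range (alphaMap R β M)).comap σ.flip

/-- The `A`-action induced on a right `C`-comodule: `a • m = Σ m₍₀₎⟨a, m₍₁₎⟩`. -/
noncomputable def inducedAction (R : Type u) [CommRing R]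
    {A : Type u} [AddCommGroup A] [Module R A]
    {C : Type u} [AddCommGroup C] [Module R C]
    (β : A →ₗ[R] C →ₗ[R] R)
    {M : Type u} [AddCommGroup M] [Module R M]
    (ϱ : M →ₗ[R] M ⊗[R] C) : A →ₗ[R] M →ₗ[R] M :=
  ((alphaMap R β M) ∘ₗ ϱ).flip

/-- `ϱ : M → M ⊗ C` is a (coassociative, counital) right `C`-comodule structure. -/
def IsRightComodule (R : Type u) [CommRing R]
    {C : Type u} [AddCommGroup C] [Module R C] [Coalgebra R C]
    {M : Type u} [AddCommGroup M] [Module R M]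
    (ϱ : M →ₗ[R] M ⊗[R] C) : Prop :=
  ((TensorProduct.assoc R M C C).toLinearMap ∘ₗ (TensorProduct.map ϱ LinearMap.id) ∘ₗ ϱ
      = (TensorProduct.map LinearMap.id (Coalgebra.comul (R := R))) ∘ₗ ϱ)
  ∧ ∀ m : M,
      (TensorProduct.rid R M)
        ((TensorProduct.map LinearMap.id (Coalgebra.counit (R := R))) (ϱ m)) = m

/-- `ϱ : N → C ⊗ N` is a (coassociative, counital) left `C`-comodule structure. -/
def IsLeftComodule (R : Type u) [CommRing R]
    {C : Type u} [AddCommGroup C] [Module R C] [Coalgebra R C]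
    {N : Type u} [AddCommGroup N] [Module R N]
    (ϱ : N →ₗ[R] C ⊗[R] N) : Prop :=
  ((TensorProduct.assoc R C C N).symm.toLinearMap ∘ₗ (TensorProduct.map LinearMap.id ϱ) ∘ₗ ϱ
      = (TensorProduct.map (Coalgebra.comul (R := R)) LinearMap.id) ∘ₗ ϱ)
  ∧ ∀ n : N,
      (TensorProduct.lid R N)
        ((TensorProduct.map (Coalgebra.counit (R := R)) LinearMap.id) (ϱ n)) = n

/-- The cotensor product `M □_C N` as a submodule of `M ⊗ N`. -/
noncomputable def cotensor (R : Type u) [CommRing R]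
    {C : Type u} [AddCommGroup C] [Module R C]
    {M : Type u} [AddCommGroup M] [Module R M]
    {N : Type u} [AddCommGroup N] [Module R N]
    (ϱM : M →ₗ[R] M ⊗[R] C) (ϱN : N →ₗ[R] C ⊗[R] N) : Submodule R (M ⊗[R] N) :=
  LinearMap.ker
    ((TensorProduct.assoc R M C N).toLinearMap ∘ₗ (TensorProduct.map ϱM LinearMap.id)
      - (TensorProduct.map LinearMap.id ϱN))

/-- The right `A`-action induced on a left `C`-comodule: `n • a = Σ ⟨a, n₍₋₁₎⟩ n₍₀₎`. -/
noncomputable def rAct (R : Type u) [CommRing R]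
    {A : Type u} [AddCommGroup A] [Module R A]
    {C : Type u} [AddCommGroup C] [Module R C]
    {N : Type u} [AddCommGroup N] [Module R N]
    (β : A →ₗ[R] C →ₗ[R] R) (ϱ : N →ₗ[R] C ⊗[R] N) (a : A) : N →ₗ[R] N :=
  (TensorProduct.lid R N).toLinearMap ∘ₗ (TensorProduct.map (β a) LinearMap.id) ∘ₗ ϱ

/-- `Hom_{A-}(B, N)`: the `A`-linear maps `B → N`, where `B` is an `A`-module via `ξ`. -/
noncomputable def homA (R : Type u) [CommRing R]
    {A B N : Type u} [Ring A] [Algebra R A] [Ring B] [Algebra R B]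
    [AddCommGroup N] [Module R N]
    (ξ : A →ₐ[R] B) (σN : A →ₗ[R] N →ₗ[R] N) : Submodule R (B →ₗ[R] N) where
  carrier := {f | ∀ (a : A) (b : B), f (ξ a * b) = σN a (f b)}
  zero_mem' := by intro a b; simp
  add_mem' := by intro f g hf hg a b; simp [hf a b, hg a b]
  smul_mem' := by intro r f hf a b; simp [hf a b]

/-- Evaluation at `1_B` as a linear map on a submodule of `Hom_R(B, N)`. -/
noncomputable def evalAtOne {R B N : Type u} [CommRing R] [Ring B] [Algebra R B]
    [AddCommGroup N] [Module R N] (Hsub : Submodule R (B →ₗ[R] N)) : ↥Hsub →ₗ[R] N where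
  toFun f := (f : B →ₗ[R] N) 1
  map_add' f g := by simp
  map_smul' r f := by simp

section Pairing

variable {R A C M : Type u} [CommRing R] [AddCommGroup A] [Module R A]
  [AddCommGroup C] [Module R C] [AddCommGroup M] [Module R M]

@[simp]
theorem alphaMap_tmul (β : A →ₗ[R] C →ₗ[R] R) (m : M) (c : C) (a : A) :
    alphaMap R β M (m ⊗ₜ c) a = β a c • m := by
  simp [alphaMap]

theorem inducedAction_apply (β : A →ₗ[R] C →ₗ[R] R) (ϱ : M →ₗ[R] M ⊗[R] C) (a : A) (m : M) :
    inducedAction R β ϱ a m = alphaMap R β M (ϱ m) a := rfl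

/-- Naturality of `alphaMap` in the module. -/
theorem alphaMap_map {M' : Type u} [AddCommGroup M'] [Module R M'] (β : A →ₗ[R] C →ₗ[R] R)
    (g : M →ₗ[R] M') (x : M ⊗[R] C) (a : A) :
    alphaMap R β M' (TensorProduct.map g LinearMap.id x) a = g (alphaMap R β M x a) := by
  induction x with
  | zero => simp
  | tmul m c => simp
  | add x y hx hy => simp [hx, hy]

/-- Under the α-condition, an element of `M ⊗ C` all of whose contractions lie in a
submodule `K` of `M` comes from `K ⊗ C`. -/
theorem exists_map_subtype_eq_of_alphaMap_mem {β : A →ₗ[R] C →ₗ[R] R}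
    (K : Submodule R M) (hα : Function.Injective (alphaMap R β (M ⧸ K)))
    (y : M ⊗[R] C) (hy : ∀ a, alphaMap R β M y a ∈ K) :
    ∃ u : ↥K ⊗[R] C, TensorProduct.map K.subtype LinearMap.id u = y := by
  have hq : TensorProduct.map K.mkQ LinearMap.id y = 0 := by
    apply hα
    ext a
    rw [alphaMap_map]
    simpa using hy a
  exact (rTensor_exact C (LinearMap.exact_subtype_mkQ K) K.mkQ_surjective y).1 hq

/-- Under the α-condition for `(A, C)` and `(B, D)`, elements of `M ⊗ (C ⊗ D)` are separated
by their contractions along `A` and `B`. -/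
theorem tensor_tensor_ext_of_alphaMap {B D : Type u} [AddCommGroup B] [Module R B]
    [AddCommGroup D] [Module R D] {βP : A →ₗ[R] C →ₗ[R] R} {βQ : B →ₗ[R] D →ₗ[R] R}
    (hP : Function.Injective (alphaMap R βP M))
    (hQ : Function.Injective (alphaMap R βQ (M ⊗[R] C)))
    {z w : M ⊗[R] (C ⊗[R] D)}
    (h : ∀ a b,
      alphaMap R βP M (alphaMap R βQ _ ((TensorProduct.assoc R M C D).symm z) b) a =
        alphaMap R βP M (alphaMap R βQ _ ((TensorProduct.assoc R M C D).symm w) b) a) :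
    z = w := by
  apply (TensorProduct.assoc R M C D).symm.injective
  apply hQ
  ext b
  apply hP
  ext a
  exact h a b

end Pairing

section Measuring

variable {R B D N : Type u} [CommRing R] [Ring B] [Algebra R B]
  [AddCommGroup D] [Module R D] [Coalgebra R D] [AddCommGroup N] [Module R N]

theorem IsMeasuring.apply_inducedAction_comul {β : B →ₗ[R] D →ₗ[R] R} (h : IsMeasuring R β)
    (b b' : B) (d : D) :
    β b (inducedAction R β (Coalgebra.comul (R := R) (A := D)) b' d) = β (b * b') d := by
  rw [inducedAction_apply, h]
  simp only [LinearMap.comp_apply]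
  generalize Coalgebra.comul (R := R) d = t
  induction t with
  | zero => simp
  | tmul d e => simp [mul_comm]
  | add x y hx hy => simp [hx, hy]

theorem IsMeasuring.alphaMap_map_inducedAction {β : B →ₗ[R] D →ₗ[R] R} (h : IsMeasuring R β)
    (x : N ⊗[R] D) (b b' : B) :
    alphaMap R β N (TensorProduct.map LinearMap.id
        (inducedAction R β (Coalgebra.comul (R := R) (A := D)) b') x) b =
      alphaMap R β N x (b * b') := by
  induction x with
  | zero => simp
  | tmul n d => simp [h.apply_inducedAction_comul]
  | add x y hx hy => simp [hx, hy]

/-- Contracting the comultiplication on the right factor of `N ⊗ D`, one leg at a time. -/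
theorem IsMeasuring.alphaMap_alphaMap_comul {β : B →ₗ[R] D →ₗ[R] R} (h : IsMeasuring R β)
    (x : N ⊗[R] D) (b b' : B) :
    alphaMap R β N (alphaMap R β _ ((TensorProduct.assoc R N D D).symm
        (TensorProduct.map LinearMap.id (Coalgebra.comul (R := R)) x)) b') b =
      alphaMap R β N x (b * b') := by
  induction x with
  | zero => simp
  | add x y hx hy => simp only [map_add, LinearMap.add_apply, hx, hy]
  | tmul n d =>
    rw [alphaMap_tmul, h]
    simp only [LinearMap.comp_apply, TensorProduct.map_tmul, LinearMap.id_apply]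
    generalize Coalgebra.comul (R := R) d = t
    induction t with
    | zero => simp
    | tmul d e => simp [smul_smul, mul_comm]
    | add x y hx hy => simp only [map_add, TensorProduct.tmul_add, LinearMap.add_apply, hx, hy,
        add_smul]

/-- An element of `N ⊗ D` lies in the cotensor product `N □_C D` if and only if its image
in `Hom_R(B, N)` is `A`-linear. -/
theorem mem_cotensor_iff_alphaMap_mem_homA {A C : Type u} [Ring A] [Algebra R A]
    [AddCommGroup C] [Module R C]
    {βP : A →ₗ[R] C →ₗ[R] R} {βQ : B →ₗ[R] D →ₗ[R] R} (hmeasQ : IsMeasuring R βQ)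
    (hP : Function.Injective (alphaMap R βP N))
    (hQ : Function.Injective (alphaMap R βQ (N ⊗[R] C)))
    (ξ : A →ₐ[R] B) (θ : D →ₗ[R] C) (hcompat : ∀ (a : A) (d : D), βQ (ξ a) d = βP a (θ d))
    (ϱN : N →ₗ[R] N ⊗[R] C) (x : N ⊗[R] D) :
    x ∈ cotensor R ϱN (TensorProduct.map θ LinearMap.id ∘ₗ Coalgebra.comul (R := R)) ↔
      alphaMap R βQ N x ∈ homA R ξ (inducedAction R βP ϱN) := by
  have hleft : ∀ a b, alphaMap R βP N (alphaMap R βQ _ ((TensorProduct.assoc R N C D).symm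
      (TensorProduct.assoc R N C D (TensorProduct.map ϱN LinearMap.id x))) b) a =
        inducedAction R βP ϱN a (alphaMap R βQ N x b) := by
    intro a b
    rw [LinearEquiv.symm_apply_apply, alphaMap_map, inducedAction_apply]
  have hcontract : ∀ a b (z : N ⊗[R] (D ⊗[R] D)),
      alphaMap R βP N (alphaMap R βQ _ ((TensorProduct.assoc R N C D).symm
        (TensorProduct.map LinearMap.id (TensorProduct.map θ LinearMap.id) z)) b) a =
      alphaMap R βQ N (alphaMap R βQ _ ((TensorProduct.assoc R N D D).symm z) b) (ξ a) := by
    intro a b z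
    induction z with
    | zero => simp
    | add x y hx hy => simp only [map_add, LinearMap.add_apply, hx, hy]
    | tmul n t =>
      induction t with
      | zero => simp
      | add x y hx hy => simp only [map_add, TensorProduct.tmul_add, LinearMap.add_apply, hx, hy]
      | tmul d e => simp [hcompat]
  have hright : ∀ a b, alphaMap R βP N (alphaMap R βQ _ ((TensorProduct.assoc R N C D).symm
      (TensorProduct.map LinearMap.id
        (TensorProduct.map θ LinearMap.id ∘ₗ Coalgebra.comul (R := R)) x)) b) a =
        alphaMap R βQ N x (ξ a * b) := by
    intro a b
    rw [← hmeasQ.alphaMap_alphaMap_comul, ← hcontract,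
      ← LinearMap.comp_apply (TensorProduct.map _ _),
      ← TensorProduct.map_comp, LinearMap.id_comp]
  rw [cotensor, LinearMap.mem_ker, LinearMap.sub_apply, sub_eq_zero]
  constructor
  · intro h a b
    rw [← hright, ← hleft, ← h]
    rfl
  · intro h
    refine tensor_tensor_ext_of_alphaMap hP hQ fun a b => ?_
    rw [hright]
    exact (hleft a b).trans (h a b).symm

end Measuring

/-- Let `P = (A,C)`, `Q = (B,D)` be measuring α-pairings (`A`, `B`
unital) and `(ξ,θ) : (B,D) → (A,C)` a morphism of measuring pairings. With `D` a left
`C`-comodule via `(θ ⊗ id) ∘ Δ_D` and `N` a counital right `C`-comodule with its induced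
`A`-action, the map `γ_N : N □_C D → Hom_A(B,N)`, `Σ nᵢ ⊗ dᵢ ↦ (b ↦ Σ nᵢ⟨b,dᵢ⟩_Q)` (the
restriction of `α^Q_N`), is a well-defined injective `B`-linear map with image the
`D`-rational part `Rat^D(Hom_A(B,N))`, inverse `f ↦ Σ f₍₀₎(1_B) ⊗ f₍₁₎`, and natural in
`N`; hence `− □_C D ≅ Coind_P^Q(−) = Rat^D(Hom_A(B,−))`. -/
theorem coinduction_iso_cotensor
    {R A B C D N : Type u} [CommRing R]
    [Ring A] [Algebra R A] [Ring B] [Algebra R B]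
    [AddCommGroup C] [Module R C] [Coalgebra R C]
    [AddCommGroup D] [Module R D] [Coalgebra R D]
    [AddCommGroup N] [Module R N]
    (βP : A →ₗ[R] C →ₗ[R] R) (hmeasP : IsMeasuring R βP)
    (honeP : βP 1 = Coalgebra.counit (R := R))
    (βQ : B →ₗ[R] D →ₗ[R] R) (hmeasQ : IsMeasuring R βQ)
    (honeQ : βQ 1 = Coalgebra.counit (R := R))
    (hαP : ∀ (X : Type u) [AddCommGroup X] [Module R X],
      Function.Injective (alphaMap R βP X))
    (hαQ : ∀ (X : Type u) [AddCommGroup X] [Module R X],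
      Function.Injective (alphaMap R βQ X))
    -- the morphism of measuring pairings `(ξ, θ)`
    (ξ : A →ₐ[R] B) (θ : D →ₗ[R] C)
    (hθcomul : (Coalgebra.comul (R := R)) ∘ₗ θ
        = (TensorProduct.map θ θ) ∘ₗ (Coalgebra.comul (R := R)))
    (hθcounit : (Coalgebra.counit (R := R) (A := C)) ∘ₗ θ = Coalgebra.counit (R := R))
    (hcompat : ∀ (a : A) (d : D), βQ (ξ a) d = βP a (θ d))
    -- `D` as a left `C`-comodule via `(θ ⊗ id) ∘ Δ_D`
    (ϱD : D →ₗ[R] C ⊗[R] D)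
    (hϱD : ϱD = (TensorProduct.map θ LinearMap.id) ∘ₗ (Coalgebra.comul (R := R)))
    -- `N` a counital right `C`-comodule, with induced `A`-action `σN`
    (ϱN : N →ₗ[R] N ⊗[R] C) (hN : IsRightComodule R ϱN) (hNinj : Function.Injective ϱN)
    (σN : A →ₗ[R] N →ₗ[R] N) (hσN : σN = inducedAction R βP ϱN)
    -- the right `B`-action `b' ⇀ d = Σ d₁⟨b', d₂⟩` on `D`
    (actD : B →ₗ[R] D →ₗ[R] D)
    (hactD : actD = inducedAction R βQ (Coalgebra.comul (R := R) (A := D)))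
    -- the `B`-module structure on `Hom_A(B,N)`: `(b' · f)(b) = f (b * b')`
    (σH : B →ₗ[R] ↥(homA R ξ σN) →ₗ[R] ↥(homA R ξ σN))
    (hσH : ∀ (b' : B) (f : ↥(homA R ξ σN)) (b : B),
      ((σH b' f : ↥(homA R ξ σN)) : B →ₗ[R] N) b = ((f : B →ₗ[R] N)) (b * b')) :
    -- `γ_N = α^Q_N` maps `N □_C D` into `Hom_A(B,N)`
    (∀ x ∈ cotensor R ϱN ϱD, alphaMap R βQ N x ∈ homA R ξ σN)
    ∧
    -- `γ_N` is `B`-linear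
    (∀ x ∈ cotensor R ϱN ϱD, ∀ b' : B,
      TensorProduct.map LinearMap.id (actD b') x ∈ cotensor R ϱN ϱD
      ∧ ∀ b : B,
          alphaMap R βQ N (TensorProduct.map LinearMap.id (actD b') x) b
            = alphaMap R βQ N x (b * b'))
    ∧
    -- `γ_N` is injective
    (∀ x ∈ cotensor R ϱN ϱD, ∀ y ∈ cotensor R ϱN ϱD,
      alphaMap R βQ N x = alphaMap R βQ N y → x = y)
    ∧
    -- the image of `γ_N` is exactly the `D`-rational part of `Hom_A(B,N)`
    (∀ f : ↥(homA R ξ σN),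
      f ∈ ratSubmodule R βQ σH
      ↔ ∃ x ∈ cotensor R ϱN ϱD, alphaMap R βQ N x = (f : B →ₗ[R] N))
    ∧
    -- the inverse is `f ↦ Σ f₍₀₎(1_B) ⊗ f₍₁₎`
    (∀ (f : ↥(homA R ξ σN)) (u : ↥(homA R ξ σN) ⊗[R] D),
      alphaMap R βQ (↥(homA R ξ σN)) u = σH.flip f →
      TensorProduct.map (evalAtOne (homA R ξ σN)) LinearMap.id u ∈ cotensor R ϱN ϱD
      ∧ alphaMap R βQ N (TensorProduct.map (evalAtOne (homA R ξ σN)) LinearMap.id u)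
          = (f : B →ₗ[R] N))
    ∧
    -- `γ` is natural in `N`
    (∀ (N' : Type u) [AddCommGroup N'] [Module R N'],
      ∀ (ϱN' : N' →ₗ[R] N' ⊗[R] C),
        IsRightComodule R ϱN' → Function.Injective ϱN' →
        ∀ g : N →ₗ[R] N',
          (ϱN' ∘ₗ g = (TensorProduct.map g LinearMap.id) ∘ₗ ϱN) →
          ∀ x ∈ cotensor R ϱN ϱD,
            TensorProduct.map g (LinearMap.id : D →ₗ[R] D) x ∈ cotensor R ϱN' ϱD
            ∧ ∀ b : B,
                alphaMap R βQ N' (TensorProduct.map g LinearMap.id x) b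
                  = g (alphaMap R βQ N x b)) := by
  subst hϱD hσN hactD
  have hmem := mem_cotensor_iff_alphaMap_mem_homA hmeasQ (hαP N) (hαQ _) ξ θ hcompat ϱN
  have hinv : ∀ (f : ↥(homA R ξ (inducedAction R βP ϱN)))
      (u : ↥(homA R ξ (inducedAction R βP ϱN)) ⊗[R] D),
      alphaMap R βQ _ u = σH.flip f →
      alphaMap R βQ N (TensorProduct.map (evalAtOne _) LinearMap.id u) = (f : B →ₗ[R] N) := by
    intro f u hu
    ext b
    rw [alphaMap_map, hu]
    exact (hσH b f 1).trans (by rw [one_mul])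
  have hinv_mem : ∀ (f : ↥(homA R ξ (inducedAction R βP ϱN)))
      (u : ↥(homA R ξ (inducedAction R βP ϱN)) ⊗[R] D),
      alphaMap R βQ _ u = σH.flip f →
      TensorProduct.map (evalAtOne _) LinearMap.id u ∈
        cotensor R ϱN (TensorProduct.map θ LinearMap.id ∘ₗ Coalgebra.comul (R := R)) := by
    intro f u hu
    rw [hmem, hinv f u hu]
    exact f.2
  refine ⟨fun x hx => (hmem x).1 hx, fun x hx b' => ⟨?_, fun b => ?_⟩,
    fun x _ y _ h => hαQ N h, fun f => ⟨?_, ?_⟩,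
    fun f u hu => ⟨hinv_mem f u hu, hinv f u hu⟩, ?_⟩
  · rw [hmem]
    intro a b
    rw [hmeasQ.alphaMap_map_inducedAction, hmeasQ.alphaMap_map_inducedAction, mul_assoc]
    exact (hmem x).1 hx a (b * b')
  · exact hmeasQ.alphaMap_map_inducedAction x b b'
  · rintro ⟨u, hu⟩
    exact ⟨_, hinv_mem f u hu, hinv f u hu⟩
  · rintro ⟨x, -, hxf⟩
    have hy : ∀ b', alphaMap R βQ _ (TensorProduct.map (alphaMap R βQ N) LinearMap.id
        ((TensorProduct.assoc R N D D).symm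
          (TensorProduct.map LinearMap.id (Coalgebra.comul (R := R)) x))) b' =
        (σH b' f : B →ₗ[R] N) := by
      intro b'
      ext b
      rw [alphaMap_map, hmeasQ.alphaMap_alphaMap_comul, hσH, hxf]
    obtain ⟨u, hu⟩ := exists_map_subtype_eq_of_alphaMap_mem _ (hαQ _) _
      fun b' => by rw [hy b']; exact (σH b' f).2
    refine ⟨u, LinearMap.ext fun b' => Subtype.ext ?_⟩
    rw [← Submodule.subtype_apply, ← alphaMap_map, hu, hy]
    rfl
  · intro N' _ _ ϱN' _ _ g hg x hx
    refine ⟨?_, alphaMap_map βQ g x⟩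
    rw [mem_cotensor_iff_alphaMap_mem_homA hmeasQ (hαP N') (hαQ _) ξ θ hcompat ϱN']
    intro a b
    rw [alphaMap_map, alphaMap_map, (hmem x).1 hx a b, inducedAction_apply, inducedAction_apply,
      ← alphaMap_map, ← LinearMap.comp_apply (TensorProduct.map _ _), ← hg]
    rfl
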